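/- arXiv:2008.09525 — 2 statements merged into one kernel-verified Lean document; each statement's English description precedes it below -/
import Mathlib

section
/- Let A be a regular Hopf coquasigroup over a field k with a faithful left integral φ and modular data: an invertible δ ∈ A with φ(a₍₁₎)a₍₂₎ = φ(a)δ and φ(S(a)) = φ(aδ) for all a, a nonzero τ ∈ k with φ∘S² = τφ, the modular automorphism σ with φ(ab) = φ(b·σ(a)), and σ' the modular automorphism of ψ = φ∘S with ψ(ab) = ψ(b·σ'(a)). Then σ'(a) = δ·σ(a)·δ⁻¹ for all a ∈ A, and σ(δ) = τ⁻¹·δ and σ'(δ) = τ⁻¹·δ. -/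
open TensorProduct

/-- A regular Hopf coquasigroup over a field `k`: a unital associative `k`-algebra `A`
with a (not necessarily coassociative) coproduct `comul : A →ₐ[k] A ⊗[k] A`, a counit
`counit : A →ₐ[k] k`, and a bijective antipode `antipode : A ≃ₗ[k] A` which is
antimultiplicative, anticomultiplicative, and satisfies the quasigroup antipode
identities. -/
structure RegularHopfCoquasigroup (k A : Type*) [Field k] [Ring A] [Algebra k A] where
  comul : A →ₐ[k] A ⊗[k] A
  counit : A →ₐ[k] k
  antipode : A ≃ₗ[k] A
  /-- `(ε ⊗ id) ∘ Δ = id` -/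
  counit_comul_left : ∀ a : A,
    (TensorProduct.lid k A) ((LinearMap.rTensor A counit.toLinearMap) (comul a)) = a
  /-- `(id ⊗ ε) ∘ Δ = id` -/
  counit_comul_right : ∀ a : A,
    (TensorProduct.rid k A) ((LinearMap.lTensor A counit.toLinearMap) (comul a)) = a
  /-- `S(ab) = S(b)S(a)` -/
  antipode_mul : ∀ a b : A, antipode (a * b) = antipode b * antipode a
  /-- `S(1) = 1` -/
  antipode_one : antipode (1 : A) = 1
  /-- `Δ ∘ S = (S ⊗ S) ∘ flip ∘ Δ` -/
  antipode_comul : ∀ a : A,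
    comul (antipode a) =
      (TensorProduct.map antipode.toLinearMap antipode.toLinearMap)
        ((TensorProduct.comm k A A) (comul a))
  /-- `S(a₍₁₎)a₍₂₎₍₁₎ ⊗ a₍₂₎₍₂₎ = 1 ⊗ a` -/
  quasi₁ : ∀ a : A,
    (LinearMap.rTensor A (LinearMap.mul' k A))
      ((TensorProduct.assoc k A A A).symm
        ((LinearMap.rTensor (A ⊗[k] A) antipode.toLinearMap)
          ((LinearMap.lTensor A comul.toLinearMap) (comul a)))) = (1 : A) ⊗ₜ[k] a
  /-- `a₍₁₎S(a₍₂₎₍₁₎) ⊗ a₍₂₎₍₂₎ = 1 ⊗ a` -/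
  quasi₂ : ∀ a : A,
    (LinearMap.rTensor A (LinearMap.mul' k A))
      ((TensorProduct.assoc k A A A).symm
        ((LinearMap.lTensor A (LinearMap.rTensor A antipode.toLinearMap))
          ((LinearMap.lTensor A comul.toLinearMap) (comul a)))) = (1 : A) ⊗ₜ[k] a
  /-- `a₍₁₎₍₁₎ ⊗ S(a₍₁₎₍₂₎)a₍₂₎ = a ⊗ 1` -/
  quasi₃ : ∀ a : A,
    (LinearMap.lTensor A (LinearMap.mul' k A))
      ((TensorProduct.assoc k A A A)
        ((LinearMap.rTensor A (LinearMap.lTensor A antipode.toLinearMap))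
          ((LinearMap.rTensor A comul.toLinearMap) (comul a)))) = a ⊗ₜ[k] (1 : A)
  /-- `a₍₁₎₍₁₎ ⊗ a₍₁₎₍₂₎S(a₍₂₎) = a ⊗ 1` -/
  quasi₄ : ∀ a : A,
    (LinearMap.lTensor A (LinearMap.mul' k A))
      ((TensorProduct.assoc k A A A)
        ((LinearMap.lTensor (A ⊗[k] A) antipode.toLinearMap)
          ((LinearMap.rTensor A comul.toLinearMap) (comul a)))) = a ⊗ₜ[k] (1 : A)

variable {k A : Type*} [Field k] [Ring A] [Algebra k A]

/-- `(id ⊗ f)` on `A ⊗[k] A`, composed with `A ⊗ k ≅ A`; so `idT f (a ⊗ b) = f b • a`,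
i.e. in Sweedler notation `idT f (Δ a) = a₍₁₎ f(a₍₂₎)`. -/
noncomputable def idT (f : A →ₗ[k] k) : A ⊗[k] A →ₗ[k] A :=
  (TensorProduct.rid k A).toLinearMap ∘ₗ LinearMap.lTensor A f

/-- `(f ⊗ id)` on `A ⊗[k] A`, composed with `k ⊗ A ≅ A`; so `Tid f (a ⊗ b) = f a • b`,
i.e. in Sweedler notation `Tid f (Δ a) = f(a₍₁₎) a₍₂₎`. -/
noncomputable def Tid (f : A →ₗ[k] k) : A ⊗[k] A →ₗ[k] A :=
  (TensorProduct.lid k A).toLinearMap ∘ₗ LinearMap.rTensor A f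

/-- A linear functional `f` on `A` is faithful if `f(a·) = 0` implies `a = 0` and
`f(·a) = 0` implies `a = 0`. -/
def Faithful (f : A →ₗ[k] k) : Prop :=
  (∀ a : A, (∀ b : A, f (a * b) = 0) → a = 0) ∧
  (∀ a : A, (∀ b : A, f (b * a) = 0) → a = 0)

/-- A left integral: a nonzero functional `φ` with `a₍₁₎ φ(a₍₂₎) = φ(a)·1`. -/
def IsLeftIntegral (H : RegularHopfCoquasigroup k A) (φ : A →ₗ[k] k) : Prop :=
  φ ≠ 0 ∧ ∀ a : A, idT φ (H.comul a) = φ a • (1 : A)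

/-- A right integral: a nonzero functional `ψ` with `ψ(a₍₁₎) a₍₂₎ = ψ(a)·1`. -/
def IsRightIntegral (H : RegularHopfCoquasigroup k A) (ψ : A →ₗ[k] k) : Prop :=
  ψ ≠ 0 ∧ ∀ a : A, Tid ψ (H.comul a) = ψ a • (1 : A)


@[simp]
theorem Tid_tmul (f : A →ₗ[k] k) (a b : A) : Tid f (a ⊗ₜ[k] b) = f a • b := by
  simp [Tid]

/-- Slicing the first leg commutes with right multiplication on the second leg. -/
theorem Tid_mul_right (f : A →ₗ[k] k) (u : A ⊗[k] A) (c : A) :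
    Tid f ((LinearMap.lTensor A (LinearMap.mul' k A))
      ((TensorProduct.assoc k A A A) (u ⊗ₜ[k] c))) = Tid f u * c := by
  induction u with
  | zero => simp
  | tmul x y => simp
  | add u v hu hv => simp only [TensorProduct.add_tmul, map_add, hu, hv, add_mul]

/-- A modular element `δ` of a nonzero functional `φ`, i.e. `φ(a₍₁₎)a₍₂₎ = φ(a)δ`, has its
antipode as a right inverse. -/
theorem RegularHopfCoquasigroup.modular_mul_antipode (H : RegularHopfCoquasigroup k A)
    {φ : A →ₗ[k] k} (hφ : φ ≠ 0) {δ : A} (hmod : ∀ a : A, Tid φ (H.comul a) = φ a • δ) :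
    δ * H.antipode δ = 1 := by
  have slice (t : A ⊗[k] A) :
      Tid φ ((LinearMap.lTensor A (LinearMap.mul' k A))
        ((TensorProduct.assoc k A A A)
          ((LinearMap.lTensor (A ⊗[k] A) H.antipode.toLinearMap)
            ((LinearMap.rTensor A H.comul.toLinearMap) t)))) =
        δ * H.antipode (Tid φ t) := by
    induction t with
    | zero => simp
    | tmul x y =>
      simp only [LinearMap.rTensor_tmul, LinearMap.lTensor_tmul, AlgHom.toLinearMap_apply,
        LinearEquiv.coe_coe, Tid_mul_right, hmod, Tid_tmul, map_smul, smul_mul_assoc,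
        mul_smul_comm]
    | add u v hu hv => simp only [map_add, hu, hv, mul_add]
  obtain ⟨a, ha⟩ : ∃ a, φ a ≠ 0 := by
    by_contra! h
    exact hφ (LinearMap.ext h)
  have key := slice (H.comul a)
  rw [H.quasi₄, Tid_tmul, hmod, map_smul, mul_smul_comm] at key
  exact (smul_right_injective A ha key).symm

/-- A faithful functional separates points through right multiplication. -/
theorem Faithful.eq_of_forall_mul_left {f : A →ₗ[k] k} (hf : Faithful f) {x y : A}
    (h : ∀ b : A, f (b * x) = f (b * y)) : x = y :=
  sub_eq_zero.mp <| hf.2 _ fun b => by rw [mul_sub, map_sub, h, sub_self]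

/-- `σ'(a) = δ σ(a) δ⁻¹`, `σ(δ) = τ⁻¹ δ` and `σ'(δ) = τ⁻¹ δ`. -/
theorem stmt_14 (k A : Type*) [Field k] [Ring A] [Algebra k A]
    (H : RegularHopfCoquasigroup k A) (φ : A →ₗ[k] k)
    (hφ : IsLeftIntegral H φ) (hf : Faithful φ)
    (δ δi : A) (hδ1 : δ * δi = 1) (hδ2 : δi * δ = 1)
    (hmod : ∀ a : A, Tid φ (H.comul a) = φ a • δ)
    (hSδ : ∀ a : A, φ (H.antipode a) = φ (a * δ))
    (τ : k) (hτ0 : τ ≠ 0)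
    (hτ : ∀ a : A, φ (H.antipode (H.antipode a)) = τ * φ a)
    (σ : A ≃ₐ[k] A) (hσ : ∀ a b : A, φ (a * b) = φ (b * σ a))
    (σ' : A ≃ₐ[k] A)
    (hσ' : ∀ a b : A, φ (H.antipode (a * b)) = φ (H.antipode (b * σ' a))) :
    (∀ a : A, σ' a = δ * σ a * δi) ∧
    σ δ = τ⁻¹ • δ ∧ σ' δ = τ⁻¹ • δ := by
  have hσ'_eq (a : A) : σ' a = δ * σ a * δi := by
    have h : δ * σ a = σ' a * δ := hf.eq_of_forall_mul_left fun b => by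
      rw [← mul_assoc, ← hσ, ← mul_assoc, ← hSδ, hσ', hSδ, mul_assoc]
    rw [h, mul_assoc, hδ1, mul_one]
  have hS : H.antipode δ = δi := by
    rw [← one_mul (H.antipode δ), ← hδ2, mul_assoc, H.modular_mul_antipode hφ.1 hmod, mul_one]
  have hSi : H.antipode δi = δ := by
    have h : H.antipode δi * δi = 1 := by
      rw [← hS, ← H.antipode_mul, hS, hδ1, H.antipode_one]
    rw [← mul_one (H.antipode δi), ← hδ2, ← mul_assoc, h, one_mul]
  have hconj (b : A) : φ (b * δ) = τ * φ (δ * b) := by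
    rw [← hτ, hSδ, ← hSi, ← H.antipode_mul, hSi, ← mul_assoc, hδ2, one_mul, hSδ]
  have hσδ : σ δ = τ⁻¹ • δ := hf.eq_of_forall_mul_left fun b => by
    rw [← hσ, mul_smul_comm, map_smul, hconj, smul_eq_mul, inv_mul_cancel_left₀ hτ0]
  refine ⟨hσ'_eq, hσδ, ?_⟩
  rw [hσ'_eq, hσδ, mul_smul_comm, smul_mul_assoc, mul_assoc, hδ1, mul_one]
end

section
/- Let A be a regular Hopf coquasigroup over a field k with a faithful left integral φ, let σ be the modular automorphism with φ(ab) = φ(b·σ(a)) for all a, b ∈ A, and let σ' be the modular automorphism of ψ = φ∘S with ψ(ab) = ψ(b·σ'(a)) for all a, b ∈ A. Then for all a ∈ A one has Δ(σ(a)) = (S² ⊗ σ)(Δ(a)) and Δ(σ'(a)) = (σ' ⊗ S⁻²)(Δ(a)) in A ⊗ A. -/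
open TensorProduct

variable {k A : Type*} [Field k] [Ring A] [Algebra k A]

theorem idT_tmul (f : A →ₗ[k] k) (x y : A) : idT f (x ⊗ₜ[k] y) = f y • x := by
  simp [idT]

theorem idT_tmul_one_mul (f : A →ₗ[k] k) (x : A) (u : A ⊗[k] A) :
    idT f ((x ⊗ₜ[k] 1) * u) = x * idT f u := by
  induction u with
  | zero => simp
  | tmul y z => simp [idT_tmul]
  | add u v hu hv => simp only [mul_add, map_add, hu, hv]

/-- A tensor is determined by its slices `(id ⊗ φ(b ·))` when `φ` is faithful. -/
theorem Faithful.ext_idT {φ : A →ₗ[k] k} (hf : Faithful φ) {u v : A ⊗[k] A}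
    (h : ∀ b : A, idT φ ((1 ⊗ₜ[k] b) * u) = idT φ ((1 ⊗ₜ[k] b) * v)) : u = v := by
  have slice : ∀ (f : A →ₗ[k] k) (b : A) (w : A ⊗[k] A),
      φ (b * Tid f w) = f (idT φ ((1 ⊗ₜ[k] b) * w)) := by
    intro f b w
    induction w with
    | zero => simp
    | tmul y z => simp [idT_tmul, Tid, mul_comm]
    | add u v hu hv => simp only [mul_add, map_add, hu, hv]
  have hT : ∀ f : A →ₗ[k] k, Tid f u = Tid f v := fun f => by
    refine sub_eq_zero.mp (hf.2 _ fun b => ?_)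
    rw [mul_sub, map_sub, slice, slice, h, sub_self]
  classical
  let B := Module.Basis.ofVectorSpace k A
  apply (TensorProduct.equivFinsuppOfBasisLeft (N := A) B).injective
  ext i
  rw [TensorProduct.equivFinsuppOfBasisLeft_apply, TensorProduct.equivFinsuppOfBasisLeft_apply]
  exact hT (B.coord i)

namespace RegularHopfCoquasigroup

variable (H : RegularHopfCoquasigroup k A)

/-- `S(x) y₍₁₎ ⊗ y₍₂₎ = (S(x) ⊗ 1) Δ(y)`. -/
theorem rTensor_mul'_antipode_comul (x y : A) :
    (LinearMap.rTensor A (LinearMap.mul' k A))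
      ((TensorProduct.assoc k A A A).symm
        ((LinearMap.rTensor (A ⊗[k] A) H.antipode.toLinearMap)
          ((LinearMap.lTensor A H.comul.toLinearMap) (x ⊗ₜ[k] y)))) =
      (H.antipode x ⊗ₜ[k] 1) * H.comul y := by
  simp only [LinearMap.lTensor_tmul, LinearMap.rTensor_tmul, AlgHom.toLinearMap_apply,
    LinearEquiv.coe_coe]
  induction H.comul y with
  | zero => simp
  | tmul y z => simp
  | add u v hu hv => simp only [TensorProduct.tmul_add, mul_add, map_add, hu, hv]

/-- Strong left invariance: `b₍₁₎ φ(a b₍₂₎) = S(a₍₁₎) φ(a₍₂₎ b)`. -/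
theorem idT_mul_comul {φ : A →ₗ[k] k} (hφ : IsLeftIntegral H φ) (a b : A) :
    idT φ ((1 ⊗ₜ[k] a) * H.comul b) =
      idT φ (LinearMap.rTensor A H.antipode.toLinearMap (H.comul a) * (1 ⊗ₜ[k] b)) := by
  rw [← H.quasi₁ a]
  induction H.comul a with
  | zero => simp
  | tmul x y =>
    rw [rTensor_mul'_antipode_comul, mul_assoc, ← map_mul, idT_tmul_one_mul, hφ.2]
    simp [idT_tmul]
  | add u v hu hv => simp only [add_mul, map_add, hu, hv]

theorem comul_modular {φ : A →ₗ[k] k} (hφ : IsLeftIntegral H φ) (hf : Faithful φ)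
    {σ : A ≃ₐ[k] A} (hσ : ∀ a b : A, φ (a * b) = φ (b * σ a)) (a : A) :
    H.comul (σ a) =
      (TensorProduct.map (H.antipode.toLinearMap ∘ₗ H.antipode.toLinearMap)
        σ.toLinearMap) (H.comul a) := by
  refine hf.ext_idT fun b => ?_
  have h₁ : ∀ u : A ⊗[k] A,
      idT φ (LinearMap.rTensor A H.antipode.toLinearMap u * (1 ⊗ₜ[k] σ a)) =
        H.antipode (idT φ ((1 ⊗ₜ[k] a) * u)) := by
    intro u
    induction u with
    | zero => simp
    | tmul x y => simp [idT_tmul, hσ a y]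
    | add u v hu hv => simp only [mul_add, add_mul, map_add, hu, hv]
  have h₂ : ∀ u : A ⊗[k] A,
      H.antipode (idT φ (LinearMap.rTensor A H.antipode.toLinearMap u * (1 ⊗ₜ[k] b))) =
        idT φ ((1 ⊗ₜ[k] b) *
          (TensorProduct.map (H.antipode.toLinearMap ∘ₗ H.antipode.toLinearMap)
            σ.toLinearMap) u) := by
    intro u
    induction u with
    | zero => simp
    | tmul x y => simp [idT_tmul, hσ y b]
    | add u v hu hv => simp only [mul_add, add_mul, map_add, hu, hv]
  rw [H.idT_mul_comul hφ, h₁, H.idT_mul_comul hφ, h₂]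

theorem comul_modular_right {φ : A →ₗ[k] k} (hφ : IsLeftIntegral H φ) (hf : Faithful φ)
    {σ : A ≃ₐ[k] A} (hσ : ∀ a b : A, φ (a * b) = φ (b * σ a))
    {σ' : A ≃ₐ[k] A}
    (hσ' : ∀ a b : A, φ (H.antipode (a * b)) = φ (H.antipode (b * σ' a))) (a : A) :
    H.comul (σ' a) =
      (TensorProduct.map σ'.toLinearMap
        (H.antipode.symm.toLinearMap ∘ₗ H.antipode.symm.toLinearMap)) (H.comul a) := by
  have key : ∀ x : A, σ (H.antipode (σ' x)) = H.antipode x := by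
    intro x
    refine sub_eq_zero.mp (hf.2 _ fun b => ?_)
    obtain ⟨c, rfl⟩ := H.antipode.surjective b
    rw [mul_sub, map_sub, ← hσ, ← H.antipode_mul, ← H.antipode_mul, ← hσ', sub_self]
  let T : A ⊗[k] A ≃ₗ[k] A ⊗[k] A :=
    TensorProduct.comm k A A ≪≫ₗ TensorProduct.congr H.antipode H.antipode ≪≫ₗ
      TensorProduct.congr (H.antipode ≪≫ₗ H.antipode) σ.toLinearEquiv
  have hT : ∀ u : A ⊗[k] A, T ((TensorProduct.map σ'.toLinearMap
        (H.antipode.symm.toLinearMap ∘ₗ H.antipode.symm.toLinearMap)) u) =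
      (TensorProduct.map H.antipode.toLinearMap H.antipode.toLinearMap)
        ((TensorProduct.comm k A A) u) := by
    intro u
    induction u with
    | zero => simp
    | tmul x y => simp [T, key]
    | add u v hu hv => simp only [map_add, hu, hv]
  apply T.injective
  rw [hT, ← H.antipode_comul, ← key a, H.comul_modular hφ hf hσ, H.antipode_comul]
  rfl

end RegularHopfCoquasigroup

/-- `Δ(σ(a)) = (S² ⊗ σ)(Δ(a))` and `Δ(σ'(a)) = (σ' ⊗ S⁻²)(Δ(a))`. -/
theorem stmt_16 (k A : Type*) [Field k] [Ring A] [Algebra k A]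
    (H : RegularHopfCoquasigroup k A) (φ : A →ₗ[k] k)
    (hφ : IsLeftIntegral H φ) (hf : Faithful φ)
    (σ : A ≃ₐ[k] A) (hσ : ∀ a b : A, φ (a * b) = φ (b * σ a))
    (σ' : A ≃ₐ[k] A)
    (hσ' : ∀ a b : A, φ (H.antipode (a * b)) = φ (H.antipode (b * σ' a))) :
    (∀ a : A, H.comul (σ a) =
      (TensorProduct.map (H.antipode.toLinearMap ∘ₗ H.antipode.toLinearMap)
        σ.toLinearMap) (H.comul a)) ∧
    (∀ a : A, H.comul (σ' a) =
      (TensorProduct.map σ'.toLinearMap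
        (H.antipode.symm.toLinearMap ∘ₗ H.antipode.symm.toLinearMap))
        (H.comul a)) := by
  exact ⟨H.comul_modular hφ hf hσ, H.comul_modular_right hφ hf hσ hσ'⟩
end
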